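/- arXiv:1704.04641 — 2 statements merged into one kernel-verified Lean document; each statement's English description precedes it below -/
import Mathlib

section
/- Define R₃₁ = (1/2)·log(1 + p₃₁/(2p₁₀ + 2p₃₀ + p₁₁ + σ)), R₁₁ = (1/2)·log(1 + p₁₁/(2p₁₀ + 2p₃₀ + σ)), R₃₀ = (1/2)·[log(1/2 + p₃₀/(2p₁₀ + σ))]⁺, and R₁₀ = (1/2)·[log(1/2 + p₁₀/σ)]⁺. Then R₁₀ + R₁₁ ≥ (C₁₄ − C₂₄ + C₂) − 1/2, R₁₀ ≥ C₂ − 1/2, R₃₀ + R₃₁ ≥ (C₁₃ − C₁₄ + C₂₄ − C₂) − 1/2, and R₃₀ ≥ (C₂₄ − C₂) − 1/2. -/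
/-- The logarithm of one plus a signal-to-noise ratio, split as a difference. -/
theorem logb_two_one_add_div {x y : ℝ} (hy : 0 < y) (hxy : 0 < x + y) :
    Real.logb 2 (1 + x / y) = Real.logb 2 (x + y) - Real.logb 2 y := by
  rw [← Real.logb_div hxy.ne' hy.ne']
  congr 1
  field_simp
  ring

/-- Replacing `1 + x / y` by `1 / 2 + (x / 2) / y` lowers the binary logarithm by one. -/
theorem logb_two_half_add_half_div {x y : ℝ} (hy : 0 < y) (hxy : 0 < x + y) :
    Real.logb 2 (1 / 2 + x / 2 / y) = Real.logb 2 (x + y) - Real.logb 2 y - 1 := by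
  have h : (1 / 2 + x / 2 / y : ℝ) = (1 + x / y) / 2 := by ring
  have hpos : 1 + x / y ≠ 0 := by
    rw [one_add_div hy.ne', add_comm y x]
    exact (div_pos hxy hy).ne'
  rw [h, Real.logb_div hpos two_ne_zero, logb_two_one_add_div hy hxy,
    Real.logb_self_eq_one one_lt_two]


theorem stmt9 (a1 a2 a3 a4 σ p10 p30 p11 p31 C1 C2 C3 C4 C13 C14 C23 C24 R10 R11 R30 R31 : ℝ)
    (ha1 : 0 < a1) (ha2 : 0 < a2) (ha3 : 0 < a3) (ha4 : 0 < a4) (hσ : 0 < σ)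
    (h12 : a2 ≤ a1) (h34 : a4 ≤ a3)
    (hC1 : C1 = 1/2 * Real.logb 2 (1 + a1/σ))
    (hC2 : C2 = 1/2 * Real.logb 2 (1 + a2/σ))
    (hC3 : C3 = 1/2 * Real.logb 2 (1 + a3/σ))
    (hC4 : C4 = 1/2 * Real.logb 2 (1 + a4/σ))
    (hC13 : C13 = 1/2 * Real.logb 2 (1 + (a1 + a3)/σ))
    (hC14 : C14 = 1/2 * Real.logb 2 (1 + (a1 + a4)/σ))
    (hC23 : C23 = 1/2 * Real.logb 2 (1 + (a2 + a3)/σ))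
    (hC24 : C24 = 1/2 * Real.logb 2 (1 + (a2 + a4)/σ))
    (hp10 : p10 = a2/2) (hp30 : p30 = a4/2)
    (hp11 : p11 = a1 - a2) (hp31 : p31 = a3 - a4)
    (hR31 : R31 = 1/2 * Real.logb 2 (1 + p31/(2*p10 + 2*p30 + p11 + σ)))
    (hR11 : R11 = 1/2 * Real.logb 2 (1 + p11/(2*p10 + 2*p30 + σ)))
    (hR30 : R30 = 1/2 * max (Real.logb 2 (1/2 + p30/(2*p10 + σ))) 0)
    (hR10 : R10 = 1/2 * max (Real.logb 2 (1/2 + p10/σ)) 0) :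
    R10 + R11 ≥ (C14 - C24 + C2) - 1/2 ∧ R10 ≥ C2 - 1/2 ∧
    R30 + R31 ≥ (C13 - C14 + C24 - C2) - 1/2 ∧ R30 ≥ (C24 - C2) - 1/2 := by
  subst hp10 hp30 hp11 hp31
  rw [logb_two_one_add_div hσ (by linarith)] at hC2 hC13 hC14 hC24
  rw [logb_two_one_add_div (by linarith) (by linarith),
    show a3 - a4 + (2 * (a2 / 2) + 2 * (a4 / 2) + (a1 - a2) + σ) = a1 + a3 + σ by ring,
    show 2 * (a2 / 2) + 2 * (a4 / 2) + (a1 - a2) + σ = a1 + a4 + σ by ring] at hR31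
  rw [logb_two_one_add_div (by linarith) (by linarith),
    show a1 - a2 + (2 * (a2 / 2) + 2 * (a4 / 2) + σ) = a1 + a4 + σ by ring,
    show 2 * (a2 / 2) + 2 * (a4 / 2) + σ = a2 + a4 + σ by ring] at hR11
  rw [logb_two_half_add_half_div (by linarith) (by linarith),
    show a4 + (2 * (a2 / 2) + σ) = a2 + a4 + σ by ring,
    show 2 * (a2 / 2) + σ = a2 + σ by ring] at hR30
  rw [logb_two_half_add_half_div hσ (by linarith)] at hR10
  have h30 := le_max_left (Real.logb 2 (a2 + a4 + σ) - Real.logb 2 (a2 + σ) - 1) 0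
  have h10 := le_max_left (Real.logb 2 (a2 + σ) - Real.logb 2 σ - 1) 0
  refine ⟨?_, ?_, ?_, ?_⟩ <;> linarith
end

section
/- Suppose b₁ ≥ b₃ ≥ b₄ ≥ b₂ > 0 and P ≤ b₁. Set p₃ = P·(b₃ − b₂)/(P + b₃). Then (1/2)·log(1 + p₃/b₂) + 1/2 ≥ (1/2)·log((P + b₂)/b₂ · b₃/(P + b₃) · (P + b₁)/b₁); 1/2 ≥ D₁; (1/2)·log((P + b₄)/(p₃ + b₄)) + 1/2 ≥ D₃ − D₁; and (1/2)·log((P + b₃)/(p₃ + b₃)) + 1/2 ≥ D₃ − D₁. -/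
theorem half_logb_two_le_add_half {x y : ℝ} (hy : 0 < y) (hyx : y ≤ 2 * x) :
    1/2 * Real.logb 2 y ≤ 1/2 * Real.logb 2 x + 1/2 := by
  have hx : 0 < x := by linarith
  have h := Real.logb_le_logb_of_le one_lt_two hy hyx
  rw [Real.logb_mul two_ne_zero hx.ne', Real.logb_self_eq_one one_lt_two] at h
  linarith

theorem one_add_div_le_two_mul_div {a b c P : ℝ} (ha : 0 < a) (hac : a ≤ c) (hcb : c ≤ b)
    (hP : 0 < P) : 1 + P/b ≤ 2 * ((P + c)/(P*(b - a)/(P + b) + c)) := by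
  have hc : 0 < c := ha.trans_le hac
  have hb : 0 < b := hc.trans_le hcb
  have hba : 0 ≤ b - a := by linarith
  have hden : 0 < P*(b - a) + c*(P + b) := by positivity
  have hl : 1 + P/b = (P + b)/b := by field_simp; ring
  have hr : 2 * ((P + c)/(P*(b - a)/(P + b) + c)) =
      2*(P + c)*(P + b)/(P*(b - a) + c*(P + b)) := by
    field_simp
  rw [hl, hr, div_le_div_iff₀ hb hden]
  have h : P*(b - a) + c*(P + b) ≤ 2*(P + c)*b := by
    nlinarith [mul_nonneg hP.le (sub_nonneg.2 hcb), mul_pos hP ha, mul_pos hc hb]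
  nlinarith [mul_le_mul_of_nonneg_left h (add_pos hP hb).le]


theorem stmt19 (b1 b2 b3 b4 P p3 D1 D2 D3 D4 : ℝ)
    (hb2 : 0 < b2) (h24 : b2 ≤ b4) (h43 : b4 ≤ b3) (h31 : b3 ≤ b1)
    (hP0 : 0 < P) (hP : P ≤ b1)
    (hD1 : D1 = 1/2 * Real.logb 2 (1 + P/b1))
    (hD2 : D2 = 1/2 * Real.logb 2 (1 + P/b2))
    (hD3 : D3 = 1/2 * Real.logb 2 (1 + P/b3))
    (hD4 : D4 = 1/2 * Real.logb 2 (1 + P/b4))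
    (hp3 : p3 = P*(b3 - b2)/(P + b3)) :
    1/2 * Real.logb 2 (1 + p3/b2) + 1/2 ≥
      1/2 * Real.logb 2 ((P + b2)/b2 * (b3/(P + b3)) * ((P + b1)/b1)) ∧
    (1/2 : ℝ) ≥ D1 ∧
    1/2 * Real.logb 2 ((P + b4)/(p3 + b4)) + 1/2 ≥ D3 - D1 ∧
    1/2 * Real.logb 2 ((P + b3)/(p3 + b3)) + 1/2 ≥ D3 - D1 := by
  have hb4 : 0 < b4 := hb2.trans_le h24
  have hb3 : 0 < b3 := hb4.trans_le h43
  have hb1 : 0 < b1 := hb3.trans_le h31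
  have hratio : P/b1 ≤ 1 := (div_le_one hb1).2 hP
  have hD1_nonneg : 0 ≤ D1 := by
    rw [hD1]
    have := Real.logb_nonneg one_lt_two (show 1 ≤ 1 + P/b1 by linarith [div_pos hP0 hb1])
    positivity
  have hD3_le (c : ℝ) (h2c : b2 ≤ c) (hc3 : c ≤ b3) :
      D3 ≤ 1/2 * Real.logb 2 ((P + c)/(p3 + c)) + 1/2 := by
    rw [hD3, hp3]
    exact half_logb_two_le_add_half (by positivity)
      (one_add_div_le_two_mul_div hb2 h2c hc3 hP0)
  refine ⟨?_, ?_, ?_, ?_⟩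
  · have hX : 1 + p3/b2 = (P + b2)/b2 * (b3/(P + b3)) := by
      rw [hp3]
      field_simp
      ring
    have hY : (P + b1)/b1 ≤ 2 := (div_le_iff₀ hb1).2 (by linarith)
    rw [hX]
    refine half_logb_two_le_add_half (by positivity) ?_
    rw [mul_comm 2]
    exact mul_le_mul_of_nonneg_left hY (by positivity)
  · have h := half_logb_two_le_add_half (x := 1) (y := 1 + P/b1) (by positivity) (by linarith)
    rw [Real.logb_one] at h
    linarith
  · linarith [hD3_le b4 h24 h43]
  · linarith [hD3_le b3 (h24.trans h43) le_rfl]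
end
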